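/- Let μ be a Borel probability measure on {1,2}^ℕ that is shift-invariant and ergodic, with μ([12121212]) > 0. Then for μ-almost every sequence γ = (γ_n) ∈ {1,2}^ℕ, letting f(γ) ∈ Δ be the unique vector with ⋂_{n≥0} C_{γ_0}C_{γ_1}⋯C_{γ_{n−1}} ℝ³_{≥0} = ℝ_{≥0} f(γ), one has limsup_{n→∞} (1/n)·log ‖(C_{γ_0}C_{γ_1}⋯C_{γ_{n−1}})ᵀ|_{f(γ)^⊥}‖_∞ ≤ (1/8)·μ([12121212])·log(4/5) < 0; in particular the second Lyapunov exponent of the cocycle with matrices {C1, C2} with respect to μ is negative. -/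

import Mathlib

open Matrix Filter MeasureTheory

noncomputable section

/-- The matrix `C1`. -/
def C1 : Matrix (Fin 3) (Fin 3) ℝ := !![1,1,0; 0,0,1; 0,1,0]

/-- The matrix `C2`. -/
def C2 : Matrix (Fin 3) (Fin 3) ℝ := !![0,1,0; 1,0,0; 0,1,1]

/-- The product `M 0 * M 1 * ... * M (n-1)`. -/
def pprod (M : ℕ → Matrix (Fin 3) (Fin 3) ℝ) (n : ℕ) : Matrix (Fin 3) (Fin 3) ℝ :=
  ((List.range n).map M).prod

/-- The image of the nonnegative orthant under `M`. -/
def cone (M : Matrix (Fin 3) (Fin 3) ℝ) : Set (Fin 3 → ℝ) :=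
  {y | ∃ x : Fin 3 → ℝ, (∀ i, 0 ≤ x i) ∧ y = M.mulVec x}

/-- The ray generated by `f`. -/
def ray (f : Fin 3 → ℝ) : Set (Fin 3 → ℝ) := {y | ∃ t : ℝ, 0 ≤ t ∧ y = t • f}

/-- The simplex of nonnegative vectors whose entries sum to 1. -/
def simplex : Set (Fin 3 → ℝ) := {x | (∀ i, 0 ≤ x i) ∧ x 0 + x 1 + x 2 = 1}

/-- The matrix indexed by an element of `{1,2}` (encoded as `Fin 2`). -/
def cMat : Fin 2 → Matrix (Fin 3) (Fin 3) ℝ := ![C1, C2]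

/-- The shift map on sequences over `{1,2}` (encoded as `Fin 2`, letter `1` being `0`). -/
def shift : (ℕ → Fin 2) → (ℕ → Fin 2) := fun γ n => γ (n + 1)

/-- The cylinder `[12121212]` of sequences starting with `1,2,1,2,1,2,1,2`. -/
def cyl8 : Set (ℕ → Fin 2) :=
  {γ | ∀ k < 8, γ k = if k % 2 = 0 then 0 else 1}

/-- The operator norm of `M` restricted to the orthogonal complement of `f`,
with respect to the sup norm on `Fin 3 → ℝ`. -/
def perpNormInf (M : Matrix (Fin 3) (Fin 3) ℝ) (f : Fin 3 → ℝ) : ℝ :=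
  sSup {r : ℝ | ∃ z : Fin 3 → ℝ, z ≠ 0 ∧ (∑ i, z i * f i) = 0 ∧ r = ‖M.mulVec z‖ / ‖z‖}

/-! ### A one-sided pointwise ergodic theorem -/

section MaximalErgodic

variable {X : Type*}

/-- The running maximum `max_{0 ≤ k ≤ n} S_k f` of the Birkhoff sums of `f` along `T`. -/
def birkhoffMax (T : X → X) (f : X → ℝ) : ℕ → X → ℝ
  | 0 => fun _ => 0
  | n + 1 => fun x => max 0 (f x + birkhoffMax T f n (T x))

lemma birkhoffMax_nonneg (T : X → X) (f : X → ℝ) (n : ℕ) (x : X) : 0 ≤ birkhoffMax T f n x := by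
  cases n with
  | zero => exact le_rfl
  | succ n => exact le_max_left _ _

lemma birkhoffMax_le_succ (T : X → X) (f : X → ℝ) (n : ℕ) (x : X) :
    birkhoffMax T f n x ≤ birkhoffMax T f (n + 1) x := by
  induction n generalizing x with
  | zero => exact birkhoffMax_nonneg _ _ _ _
  | succ n ih => exact max_le_max le_rfl (add_le_add le_rfl (ih (T x)))

lemma birkhoffMax_mono (T : X → X) (f : X → ℝ) (x : X) :
    Monotone fun n => birkhoffMax T f n x :=
  monotone_nat_of_le_succ fun n => birkhoffMax_le_succ T f n x

lemma birkhoffSum_le_birkhoffMax (T : X → X) (f : X → ℝ) (n : ℕ) (x : X) :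
    birkhoffSum T f n x ≤ birkhoffMax T f n x := by
  induction n generalizing x with
  | zero => simp [birkhoffMax]
  | succ n ih =>
    rw [birkhoffSum_succ']
    exact (add_le_add le_rfl (ih (T x))).trans (le_max_right _ _)

/-- The set of points whose Birkhoff sums have unbounded running maximum. -/
def unboundedBirkhoff (T : X → X) (f : X → ℝ) : Set X :=
  {x | ∀ m : ℕ, ∃ n, (m : ℝ) < birkhoffMax T f n x}

lemma preimage_unboundedBirkhoff (T : X → X) (f : X → ℝ) :
    T ⁻¹' unboundedBirkhoff T f = unboundedBirkhoff T f := by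
  ext x
  constructor
  · intro h m
    obtain ⟨k, hk⟩ := exists_nat_gt ((m : ℝ) - f x)
    obtain ⟨n, hn⟩ := h k
    exact ⟨n + 1, lt_max_of_lt_right (by linarith)⟩
  · intro h m
    obtain ⟨k, hk⟩ := exists_nat_gt (max 0 ((m : ℝ) + f x))
    obtain ⟨n, hn⟩ := h k
    have h0 := (le_max_left _ _).trans_lt hk
    have h1 := (le_max_right _ _).trans_lt hk
    have h2 := hn.trans_le (birkhoffMax_le_succ T f n x)
    refine ⟨n, ?_⟩
    rcases lt_max_iff.mp h2 with h3 | h3 <;> linarith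

variable [MeasurableSpace X] {T : X → X} {f : X → ℝ} {μ : Measure X}

lemma measurable_birkhoffMax (hT : Measurable T) (hf : Measurable f) (n : ℕ) :
    Measurable (birkhoffMax T f n) := by
  induction n with
  | zero => exact measurable_const
  | succ n ih => exact measurable_const.max (hf.add (ih.comp hT))

lemma integrable_birkhoffMax (hT : MeasurePreserving T μ μ)
    (hf : Integrable f μ) (n : ℕ) : Integrable (birkhoffMax T f n) μ := by
  induction n with
  | zero => exact integrable_zero _ _ _
  | succ n ih =>
    exact (integrable_zero X ℝ μ).sup (hf.add (hT.integrable_comp_of_integrable ih))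

/-- If `∫ f < 0`, then the Birkhoff sums of `f` are almost surely bounded above. -/
theorem Ergodic.ae_birkhoffSum_le (hT : Ergodic T μ) (hfm : Measurable f)
    (hf : Integrable f μ) (hneg : ∫ x, f x ∂μ < 0) :
    ∀ᵐ x ∂μ, ∃ C : ℝ, ∀ n, birkhoffSum T f n x ≤ C := by
  have hmp := hT.toMeasurePreserving
  have hE : MeasurableSet (unboundedBirkhoff T f) := by
    have : unboundedBirkhoff T f = ⋂ m : ℕ, ⋃ n : ℕ, {x | (m : ℝ) < birkhoffMax T f n x} := by
      ext x; simp [unboundedBirkhoff]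
    rw [this]
    exact .iInter fun m => .iUnion fun n =>
      measurableSet_lt measurable_const (measurable_birkhoffMax hmp.measurable hfm n)
  rcases hT.toPreErgodic.ae_empty_or_univ hE (preimage_unboundedBirkhoff T f) with h | h
  · filter_upwards [eventuallyEq_empty.mp h] with x hx
    simp only [unboundedBirkhoff, Set.mem_ofPred_eq, not_forall, not_exists, not_lt] at hx
    obtain ⟨m, hm⟩ := hx
    exact ⟨m, fun n => (birkhoffSum_le_birkhoffMax T f n x).trans (hm n)⟩
  · exfalso
    have hint := integrable_birkhoffMax hmp hf
    have hintT : ∀ n, Integrable (fun x => birkhoffMax T f n (T x)) μ := fun n =>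
      hmp.integrable_comp_of_integrable (hint n)
    have hlim : Tendsto (fun n => ∫ x, (birkhoffMax T f (n + 1) x - birkhoffMax T f n (T x)) ∂μ)
        atTop (nhds (∫ x, f x ∂μ)) := by
      refine tendsto_integral_of_dominated_convergence (fun x => |f x|)
        (fun n => ((hint (n + 1)).sub (hintT n)).aestronglyMeasurable) hf.abs
        (fun n => .of_forall fun x => ?_) ?_
      · have h0 := birkhoffMax_nonneg T f n (T x)
        simp only [birkhoffMax, Real.norm_eq_abs]
        rcases max_cases 0 (f x + birkhoffMax T f n (T x)) with ⟨h1, h2⟩ | ⟨h1, h2⟩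
        · rw [h1, abs_le]
          constructor <;> linarith [le_abs_self (f x), neg_abs_le (f x)]
        · rw [h1, add_sub_cancel_right]
      · filter_upwards [eventuallyEq_univ.mp h] with x hx
        rw [← preimage_unboundedBirkhoff] at hx
        obtain ⟨k, hk⟩ := exists_nat_gt (-f x)
        obtain ⟨n, hn⟩ := hx k
        refine tendsto_const_nhds.congr' ?_
        filter_upwards [eventually_ge_atTop n] with m hm
        have := birkhoffMax_mono T f (T x) hm
        simp only [birkhoffMax] at this ⊢
        rw [max_eq_right (by linarith), add_sub_cancel_right]
    refine hneg.not_ge (ge_of_tendsto' hlim fun n => ?_)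
    have hcomp : ∫ x, birkhoffMax T f n (T x) ∂μ = ∫ x, birkhoffMax T f n x ∂μ := by
      conv_rhs => rw [← hmp.map_eq]
      rw [integral_map hmp.measurable.aemeasurable
        (measurable_birkhoffMax hmp.measurable hfm n).aestronglyMeasurable]
    rw [integral_sub (hint _) (hintT n), hcomp, sub_nonneg]
    exact integral_mono (hint n) (hint (n + 1)) (birkhoffMax_le_succ T f n)

/-- Almost surely, orbits visit `A` with lower frequency at least any `a < μ A`. -/
theorem Ergodic.ae_mul_le_birkhoffSum_indicator_add [IsProbabilityMeasure μ] (hT : Ergodic T μ)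
    {A : Set X} (hA : MeasurableSet A) {a : ℝ} (ha : a < (μ A).toReal) :
    ∀ᵐ x ∂μ, ∃ C : ℝ, ∀ n : ℕ, n * a ≤ birkhoffSum T (A.indicator 1) n x + C := by
  have hAm : Measurable (A.indicator (1 : X → ℝ)) := measurable_one.indicator hA
  have hAi : Integrable (A.indicator (1 : X → ℝ)) μ := (integrable_const (1 : ℝ)).indicator hA
  have hneg : ∫ x, (a - A.indicator (1 : X → ℝ) x) ∂μ < 0 := by
    rw [integral_sub (integrable_const a) hAi, integral_indicator_one hA]
    simpa [Measure.real] using ha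
  filter_upwards [hT.ae_birkhoffSum_le (measurable_const.sub hAm)
    ((integrable_const a).sub hAi) hneg] with x ⟨C, hC⟩
  refine ⟨C, fun n => ?_⟩
  have := hC n
  simp only [birkhoffSum, Pi.sub_apply, Finset.sum_sub_distrib, Finset.sum_const,
    Finset.card_range, nsmul_eq_mul] at this ⊢
  linarith

end MaximalErgodic

/-! ### A norm that the transposed matrices do not expand -/

/-- A vector with neither only positive nor only negative entries. -/
def MixedSign (z : Fin 3 → ℝ) : Prop := (∃ i, z i ≤ 0) ∧ ∃ i, 0 ≤ z i

/-- A polyhedral norm on `ℝ³` adapted to the matrices `C1ᵀ` and `C2ᵀ`. -/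
def adaptedNorm (z : Fin 3 → ℝ) : ℝ :=
  max (max |z 0 - z 1| |z 1 - z 2|) (max |z 0 - z 2| |z 0 - z 1 + z 2|)

lemma adaptedNorm_le_iff (z : Fin 3 → ℝ) (B : ℝ) : adaptedNorm z ≤ B ↔
    ((-B ≤ z 0 - z 1 ∧ z 0 - z 1 ≤ B) ∧ (-B ≤ z 1 - z 2 ∧ z 1 - z 2 ≤ B)) ∧
      (-B ≤ z 0 - z 2 ∧ z 0 - z 2 ≤ B) ∧ (-B ≤ z 0 - z 1 + z 2 ∧ z 0 - z 1 + z 2 ≤ B) := by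
  simp only [adaptedNorm, max_le_iff, abs_le]

lemma adaptedNorm_nonneg (z : Fin 3 → ℝ) : 0 ≤ adaptedNorm z :=
  (abs_nonneg _).trans ((le_max_left _ _).trans (le_max_left _ _))

lemma norm_le_adaptedNorm {z : Fin 3 → ℝ} (hz : MixedSign z) : ‖z‖ ≤ adaptedNorm z := by
  rw [pi_norm_le_iff_of_nonneg (adaptedNorm_nonneg z)]
  obtain ⟨⟨⟨h1, h2⟩, h3, h4⟩, ⟨h5, h6⟩, -⟩ := (adaptedNorm_le_iff z _).mp le_rfl
  obtain ⟨⟨i, hi⟩, j, hj⟩ := hz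
  intro k
  rw [Real.norm_eq_abs, abs_le]
  fin_cases i <;> fin_cases j <;> fin_cases k <;> simp at hi hj ⊢ <;> constructor <;> linarith

lemma adaptedNorm_le_norm (z : Fin 3 → ℝ) : adaptedNorm z ≤ 3 * ‖z‖ := by
  have h i := abs_le.mp (norm_le_pi_norm z i)
  obtain ⟨h0, h0'⟩ := h 0
  obtain ⟨h1, h1'⟩ := h 1
  obtain ⟨h2, h2'⟩ := h 2
  have := norm_nonneg z
  rw [adaptedNorm_le_iff]
  refine ⟨⟨⟨?_, ?_⟩, ?_, ?_⟩, ⟨?_, ?_⟩, ?_, ?_⟩ <;> linarith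

lemma cMat_zero_transpose_mulVec (z : Fin 3 → ℝ) :
    (cMat 0)ᵀ *ᵥ z = ![z 0, z 0 + z 2, z 1] := by
  ext i; fin_cases i <;> simp [cMat, C1, mulVec, dotProduct, Fin.sum_univ_three]

lemma cMat_one_transpose_mulVec (z : Fin 3 → ℝ) :
    (cMat 1)ᵀ *ᵥ z = ![z 1, z 0 + z 2, z 2] := by
  ext i; fin_cases i <;> simp [cMat, C2, mulVec, dotProduct, Fin.sum_univ_three]

lemma norm_le_two_mul_norm_cMat_transpose_mulVec (a : Fin 2) (z : Fin 3 → ℝ) :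
    ‖z‖ ≤ 2 * ‖(cMat a)ᵀ *ᵥ z‖ := by
  have h i := abs_le.mp (norm_le_pi_norm ((cMat a)ᵀ *ᵥ z) i)
  obtain ⟨h0, h0'⟩ := h 0
  obtain ⟨h1, h1'⟩ := h 1
  obtain ⟨h2, h2'⟩ := h 2
  have hnn := norm_nonneg ((cMat a)ᵀ *ᵥ z)
  rw [pi_norm_le_iff_of_nonneg (by positivity)]
  intro k
  rw [Real.norm_eq_abs, abs_le]
  generalize ‖(cMat a)ᵀ *ᵥ z‖ = B at *
  fin_cases a <;>
    simp [cMat_zero_transpose_mulVec, cMat_one_transpose_mulVec] at h0 h0' h1 h1' h2 h2' <;>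
    fin_cases k <;> simp <;> constructor <;> linarith

lemma adaptedNorm_cMat_transpose_mulVec_le (a : Fin 2) {z : Fin 3 → ℝ}
    (hz : MixedSign ((cMat a)ᵀ *ᵥ z)) : adaptedNorm ((cMat a)ᵀ *ᵥ z) ≤ adaptedNorm z := by
  obtain ⟨⟨⟨h1, h2⟩, h3, h4⟩, ⟨h5, h6⟩, h7, h8⟩ := (adaptedNorm_le_iff z _).mp le_rfl
  obtain ⟨⟨i, hi⟩, j, hj⟩ := hz
  rw [adaptedNorm_le_iff]
  generalize adaptedNorm z = B at *
  fin_cases a <;>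
    simp only [Fin.zero_eta, Fin.mk_one, cMat_zero_transpose_mulVec,
      cMat_one_transpose_mulVec] at hi hj ⊢ <;>
    fin_cases i <;> fin_cases j <;> simp at hi hj ⊢ <;>
    refine ⟨⟨⟨?_, ?_⟩, ?_, ?_⟩, ⟨?_, ?_⟩, ?_, ?_⟩ <;> linarith

lemma adaptedNorm_block_le {z w : Fin 3 → ℝ}
    (hw : w = (cMat 1)ᵀ *ᵥ (cMat 0)ᵀ *ᵥ (cMat 1)ᵀ *ᵥ (cMat 0)ᵀ *ᵥ
      (cMat 1)ᵀ *ᵥ (cMat 0)ᵀ *ᵥ (cMat 1)ᵀ *ᵥ (cMat 0)ᵀ *ᵥ z)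
    (hm : MixedSign w) : adaptedNorm w ≤ 4 / 5 * adaptedNorm z := by
  obtain ⟨⟨⟨h1, h2⟩, h3, h4⟩, ⟨h5, h6⟩, h7, h8⟩ := (adaptedNorm_le_iff z _).mp le_rfl
  obtain ⟨⟨i, hi⟩, j, hj⟩ := hm
  rw [adaptedNorm_le_iff]
  generalize adaptedNorm z = B at *
  simp only [cMat_zero_transpose_mulVec, cMat_one_transpose_mulVec] at hw
  have w0 : w 0 = _ := congrFun hw 0
  have w1 : w 1 = _ := congrFun hw 1
  have w2 : w 2 = _ := congrFun hw 2
  simp at w0 w1 w2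
  fin_cases i <;> fin_cases j <;> simp at hi hj ⊢ <;>
    refine ⟨⟨⟨?_, ?_⟩, ?_, ?_⟩, ⟨?_, ?_⟩, ?_, ?_⟩ <;> linarith

/-! ### Growth of orbits of the transposed cocycle -/

lemma pprod_succ (M : ℕ → Matrix (Fin 3) (Fin 3) ℝ) (n : ℕ) :
    pprod M (n + 1) = pprod M n * M n := by
  simp [pprod, List.range_succ]

lemma mixedSign_transpose_mulVec {A : Matrix (Fin 3) (Fin 3) ℝ} {f z : Fin 3 → ℝ}
    (hf : f ≠ 0) (hfA : f ∈ cone A) (hz : z ⬝ᵥ f = 0) : MixedSign (Aᵀ *ᵥ z) := by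
  obtain ⟨x, hx, rfl⟩ := hfA
  have hzero : (Aᵀ *ᵥ z) ⬝ᵥ x = 0 := by
    rw [mulVec_transpose, ← dotProduct_mulVec, hz]
  have hx0 : ∃ i, 0 < x i := by
    by_contra! h
    exact hf (by rw [show x = 0 from funext fun i => le_antisymm (h i) (hx i), mulVec_zero])
  obtain ⟨k, hk⟩ := hx0
  constructor
  · by_contra! h
    refine (Finset.sum_pos' (fun i _ => mul_nonneg (h i).le (hx i))
      ⟨k, Finset.mem_univ k, mul_pos (h k) hk⟩).ne' hzero
  · by_contra! h
    refine (Finset.sum_neg' (fun i _ => mul_nonpos_of_nonpos_of_nonneg (h i).le (hx i))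
      ⟨k, Finset.mem_univ k, mul_neg_of_neg_of_pos (h k) hk⟩).ne hzero

lemma shift_iterate_apply (γ : ℕ → Fin 2) (n k : ℕ) : shift^[n] γ k = γ (n + k) := by
  induction n generalizing γ with
  | zero => simp
  | succ n ih =>
    rw [Function.iterate_succ_apply, ih]
    simp only [shift]
    congr 1
    omega

lemma measurableSet_cyl8 : MeasurableSet cyl8 := by
  have : cyl8 = ⋂ k : ℕ, ⋂ _ : k < 8,
      (fun γ : ℕ → Fin 2 => γ k) ⁻¹' {if k % 2 = 0 then 0 else 1} := by
    ext γ; simp [cyl8]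
  rw [this]
  exact .iInter fun k => .iInter fun _ => measurable_pi_apply k (measurableSet_singleton _)

/-- The number of `k < n` such that the word `12121212` occurs in `γ` at position `k`. -/
abbrev visits (n : ℕ) (γ : ℕ → Fin 2) : ℝ := birkhoffSum shift (cyl8.indicator 1) n γ

section Orbit

variable {γ : ℕ → Fin 2} {y : ℕ → Fin 3 → ℝ}

lemma antitone_adaptedNorm_orbit (hy : ∀ n, y (n + 1) = (cMat (γ n))ᵀ *ᵥ y n)
    (hm : ∀ n, MixedSign (y n)) : Antitone fun n => adaptedNorm (y n) :=
  antitone_nat_of_succ_le fun n => by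
    have := hm (n + 1)
    rw [hy] at this ⊢
    exact adaptedNorm_cMat_transpose_mulVec_le _ this

lemma adaptedNorm_add_eight_le (hy : ∀ n, y (n + 1) = (cMat (γ n))ᵀ *ᵥ y n)
    (hm : ∀ n, MixedSign (y n)) (n : ℕ) :
    adaptedNorm (y (n + 8)) ≤
      Real.exp (Real.log (4 / 5) * cyl8.indicator 1 (shift^[n] γ)) * adaptedNorm (y n) := by
  by_cases h : shift^[n] γ ∈ cyl8
  · rw [Set.indicator_of_mem h, Pi.one_apply, mul_one, Real.exp_log (by norm_num)]
    have hγ : ∀ k < 8, γ (n + k) = if k % 2 = 0 then 0 else 1 := fun k hk => by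
      have := h k hk
      rwa [shift_iterate_apply] at this
    refine adaptedNorm_block_le ?_ (hm _)
    have e (k : ℕ) (hk : k < 8) :
        y (n + k + 1) = (cMat (if k % 2 = 0 then 0 else 1))ᵀ *ᵥ y (n + k) := by
      rw [hy, hγ k hk]
    rw [show n + 8 = n + 7 + 1 from rfl, e 7 (by norm_num), show n + 7 = n + 6 + 1 from rfl,
      e 6 (by norm_num), show n + 6 = n + 5 + 1 from rfl, e 5 (by norm_num),
      show n + 5 = n + 4 + 1 from rfl, e 4 (by norm_num), show n + 4 = n + 3 + 1 from rfl,
      e 3 (by norm_num), show n + 3 = n + 2 + 1 from rfl, e 2 (by norm_num),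
      show n + 2 = n + 1 + 1 from rfl, e 1 (by norm_num), e 0 (by norm_num)]
    simp
  · rw [Set.indicator_of_notMem h, mul_zero, Real.exp_zero, one_mul]
    exact antitone_adaptedNorm_orbit hy hm (Nat.le_add_right n 8)

lemma adaptedNorm_add_seven_pow_le (hy : ∀ n, y (n + 1) = (cMat (γ n))ᵀ *ᵥ y n)
    (hm : ∀ n, MixedSign (y n)) (n : ℕ) :
    adaptedNorm (y (n + 7)) ^ 8 ≤
      Real.exp (Real.log (4 / 5) * visits n γ) * adaptedNorm (y 0) ^ 8 := by
  have hanti := antitone_adaptedNorm_orbit hy hm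
  have hprod : ∏ k ∈ Finset.range 8, adaptedNorm (y (n + k)) ≤
      Real.exp (Real.log (4 / 5) * visits n γ) *
        ∏ k ∈ Finset.range 8, adaptedNorm (y (0 + k)) := by
    induction n with
    | zero => simp [visits]
    | succ n ih =>
      have hstep := adaptedNorm_add_eight_le hy hm n
      rw [Finset.prod_range_succ'] at ih
      rw [Finset.prod_range_succ, visits, birkhoffSum_succ, mul_add, Real.exp_add]
      have hshift : ∏ k ∈ Finset.range 7, adaptedNorm (y (n + 1 + k)) =
          ∏ k ∈ Finset.range 7, adaptedNorm (y (n + (k + 1))) :=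
        Finset.prod_congr rfl fun k _ => by rw [add_assoc, add_comm 1 k]
      have hnn : 0 ≤ ∏ k ∈ Finset.range 7, adaptedNorm (y (n + (k + 1))) :=
        Finset.prod_nonneg fun k _ => adaptedNorm_nonneg _
      rw [hshift]
      calc _ ≤ (∏ k ∈ Finset.range 7, adaptedNorm (y (n + (k + 1)))) *
            (Real.exp (Real.log (4 / 5) * cyl8.indicator 1 (shift^[n] γ)) * adaptedNorm (y n)) :=
          mul_le_mul_of_nonneg_left hstep hnn
        _ = Real.exp (Real.log (4 / 5) * cyl8.indicator 1 (shift^[n] γ)) *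
            ((∏ k ∈ Finset.range 7, adaptedNorm (y (n + (k + 1)))) * adaptedNorm (y (n + 0))) := by
          rw [add_zero]; ring
        _ ≤ _ := mul_le_mul_of_nonneg_left ih (Real.exp_nonneg _)
        _ = _ := by ring
  have hlow : adaptedNorm (y (n + 7)) ^ 8 ≤ ∏ k ∈ Finset.range 8, adaptedNorm (y (n + k)) := by
    simpa using Finset.prod_le_prod (s := Finset.range 8)
      (fun k _ => adaptedNorm_nonneg (y (n + 7)))
      (fun k hk => hanti (show n + k ≤ n + 7 by have := Finset.mem_range.mp hk; omega))
  have hup : ∏ k ∈ Finset.range 8, adaptedNorm (y (0 + k)) ≤ adaptedNorm (y 0) ^ 8 := by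
    simpa using Finset.prod_le_prod (s := Finset.range 8)
      (fun k _ => adaptedNorm_nonneg (y (0 + k)))
      (fun k _ => hanti (Nat.zero_le (0 + k)))
  exact hlow.trans (hprod.trans (mul_le_mul_of_nonneg_left hup (Real.exp_nonneg _)))

lemma norm_orbit_add_seven_le (hy : ∀ n, y (n + 1) = (cMat (γ n))ᵀ *ᵥ y n)
    (hm : ∀ n, MixedSign (y n)) (n : ℕ) :
    ‖y (n + 7)‖ ≤ 3 * Real.exp (Real.log (4 / 5) * visits n γ / 8) * ‖y 0‖ := by
  rw [← pow_le_pow_iff_left₀ (norm_nonneg _) (by positivity) (by norm_num : (8 : ℕ) ≠ 0)]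
  calc ‖y (n + 7)‖ ^ 8 ≤ adaptedNorm (y (n + 7)) ^ 8 :=
        pow_le_pow_left₀ (norm_nonneg _) (norm_le_adaptedNorm (hm _)) 8
    _ ≤ Real.exp (Real.log (4 / 5) * visits n γ) * adaptedNorm (y 0) ^ 8 :=
        adaptedNorm_add_seven_pow_le hy hm n
    _ ≤ Real.exp (Real.log (4 / 5) * visits n γ) * (3 * ‖y 0‖) ^ 8 :=
        mul_le_mul_of_nonneg_left
          (pow_le_pow_left₀ (adaptedNorm_nonneg _) (adaptedNorm_le_norm _) 8) (Real.exp_nonneg _)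
    _ = _ := by
        rw [mul_pow, mul_pow, mul_pow, ← Real.exp_nat_mul]
        push_cast
        rw [mul_div_cancel₀ _ (by norm_num : (8 : ℝ) ≠ 0)]
        ring

lemma norm_orbit_zero_le (hy : ∀ n, y (n + 1) = (cMat (γ n))ᵀ *ᵥ y n) (n : ℕ) :
    ‖y 0‖ ≤ 2 ^ n * ‖y n‖ := by
  induction n with
  | zero => simp
  | succ n ih =>
    have := norm_le_two_mul_norm_cMat_transpose_mulVec (γ n) (y n)
    rw [← hy] at this
    rw [pow_succ, mul_assoc]
    exact ih.trans (mul_le_mul_of_nonneg_left this (by positivity))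

end Orbit

lemma exists_ne_zero_orthogonal (f : Fin 3 → ℝ) : ∃ z : Fin 3 → ℝ, z ≠ 0 ∧ z ⬝ᵥ f = 0 := by
  by_cases h : f 0 = 0
  · refine ⟨![1, 0, 0], fun h' => ?_, by simp [dotProduct, Fin.sum_univ_three, h]⟩
    simpa using congrFun h' 0
  · refine ⟨![f 1, -f 0, 0], fun h' => h ?_, ?_⟩
    · simpa using congrFun h' 1
    · simp [dotProduct, Fin.sum_univ_three]; ring

section Bounds

variable {γ : ℕ → Fin 2} {f : Fin 3 → ℝ}

lemma norm_transpose_pprod_mulVec_div_le (hf : f ≠ 0)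
    (hcone : ∀ n, f ∈ cone (pprod (fun m => cMat (γ m)) n)) (n : ℕ) {z : Fin 3 → ℝ} (hz : z ≠ 0)
    (hzf : z ⬝ᵥ f = 0) :
    ‖(pprod (fun m => cMat (γ m)) (n + 7))ᵀ *ᵥ z‖ / ‖z‖ ≤
      3 * Real.exp (Real.log (4 / 5) * visits n γ / 8) := by
  rw [div_le_iff₀ (norm_pos_iff.mpr hz)]
  have := norm_orbit_add_seven_le (γ := γ)
    (y := fun n => (pprod (fun m => cMat (γ m)) n)ᵀ *ᵥ z)
    (fun n => by simp only [pprod_succ, transpose_mul, mulVec_mulVec])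
    (fun n => mixedSign_transpose_mulVec hf (hcone n) hzf) n
  simpa [pprod] using this

lemma perpNormInf_add_seven_le (hf : f ≠ 0)
    (hcone : ∀ n, f ∈ cone (pprod (fun m => cMat (γ m)) n)) (n : ℕ) :
    perpNormInf (pprod (fun m => cMat (γ m)) (n + 7))ᵀ f ≤
      3 * Real.exp (Real.log (4 / 5) * visits n γ / 8) := by
  refine Real.sSup_le ?_ (by positivity)
  rintro r ⟨z, hz, hzf, rfl⟩
  exact norm_transpose_pprod_mulVec_div_le hf hcone n hz hzf

lemma inv_two_pow_le_perpNormInf_add_seven (hf : f ≠ 0)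
    (hcone : ∀ n, f ∈ cone (pprod (fun m => cMat (γ m)) n)) (n : ℕ) :
    (2 ^ (n + 7))⁻¹ ≤ perpNormInf (pprod (fun m => cMat (γ m)) (n + 7))ᵀ f := by
  obtain ⟨z, hz, hzf⟩ := exists_ne_zero_orthogonal f
  refine le_trans ?_ (le_csSup ⟨3 * Real.exp (Real.log (4 / 5) * visits n γ / 8), ?_⟩
    ⟨z, hz, hzf, rfl⟩)
  · have := norm_orbit_zero_le (γ := γ)
      (y := fun n => (pprod (fun m => cMat (γ m)) n)ᵀ *ᵥ z)
      (fun n => by simp only [pprod_succ, transpose_mul, mulVec_mulVec]) (n + 7)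
    rw [le_div_iff₀ (norm_pos_iff.mpr hz), inv_mul_le_iff₀ (by positivity)]
    simpa [pprod] using this
  · rintro r ⟨w, hw, hwf, rfl⟩
    exact norm_transpose_pprod_mulVec_div_le hf hcone n hw hwf

lemma limsup_log_perpNormInf_le (hf : f ≠ 0)
    (hcone : ∀ n, f ∈ cone (pprod (fun m => cMat (γ m)) n)) {a C : ℝ}
    (hC : ∀ n : ℕ, n * a ≤ visits n γ + C) :
    limsup (fun n : ℕ =>
      (1 / (n : ℝ)) * Real.log (perpNormInf (pprod (fun m => cMat (γ m)) n)ᵀ f)) atTop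
        ≤ (1 / 8) * a * Real.log (4 / 5) := by
  have hlog : Real.log (4 / 5) < 0 := Real.log_neg (by norm_num) (by norm_num)
  have hlim : Tendsto (fun n : ℕ => (Real.log 3 - Real.log (4 / 5) * (C + 7 * a) / 8) / (n : ℝ) +
      (1 / 8) * a * Real.log (4 / 5)) atTop (nhds ((1 / 8) * a * Real.log (4 / 5))) := by
    simpa using (tendsto_const_div_atTop_nhds_zero_nat
      (Real.log 3 - Real.log (4 / 5) * (C + 7 * a) / 8)).add_const ((1 / 8) * a * Real.log (4 / 5))
  have hpos (n : ℕ) : 0 < perpNormInf (pprod (fun m => cMat (γ m)) (n + 7))ᵀ f :=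
    lt_of_lt_of_le (by positivity) (inv_two_pow_le_perpNormInf_add_seven hf hcone n)
  refine (limsup_le_limsup ?_ ?_ hlim.isBoundedUnder_le).trans hlim.limsup_eq.le
  · filter_upwards [eventually_ge_atTop 7] with m hm
    obtain ⟨n, rfl⟩ := Nat.exists_eq_add_of_le' hm
    have hn : (0 : ℝ) < ((n + 7 : ℕ) : ℝ) := by positivity
    have hle := Real.log_le_log (hpos n) (perpNormInf_add_seven_le hf hcone n)
    rw [Real.log_mul (by norm_num) (Real.exp_ne_zero _), Real.log_exp] at hle
    have hmul := mul_le_mul_of_nonpos_left (hC n) hlog.le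
    rw [one_div_mul_eq_div, div_add' _ _ _ hn.ne']
    refine div_le_div_of_nonneg_right (hle.trans ?_) hn.le
    push_cast
    linarith
  · refine IsBoundedUnder.isCoboundedUnder_le ⟨-Real.log 2, ?_⟩
    rw [eventually_map]
    filter_upwards [eventually_ge_atTop 7] with m hm
    obtain ⟨n, rfl⟩ := Nat.exists_eq_add_of_le' hm
    have hn : (0 : ℝ) < ((n + 7 : ℕ) : ℝ) := by positivity
    have hle := Real.log_le_log (by positivity) (inv_two_pow_le_perpNormInf_add_seven hf hcone n)
    rw [Real.log_inv, Real.log_pow] at hle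
    rw [one_div_mul_eq_div, le_div_iff₀ hn]
    linarith

end Bounds

theorem second_lyapunov_exponent_negative
    (μ : Measure (ℕ → Fin 2)) [IsProbabilityMeasure μ]
    (herg : Ergodic shift μ) (hcyl : 0 < μ cyl8) :
    ∀ᵐ γ ∂μ, ∀ f ∈ simplex,
      (⋂ n : ℕ, cone (pprod (fun m => cMat (γ m)) n)) = ray f →
      (limsup (fun n : ℕ =>
          (1 / (n : ℝ)) * Real.log (perpNormInf (pprod (fun m => cMat (γ m)) n)ᵀ f)) atTop
        ≤ (1 / 8) * (μ cyl8).toReal * Real.log (4 / 5) ∧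
      (1 / 8) * (μ cyl8).toReal * Real.log (4 / 5) < 0) := by
  have hlog : Real.log (4 / 5) < 0 := Real.log_neg (by norm_num) (by norm_num)
  have hpos : 0 < (μ cyl8).toReal := ENNReal.toReal_pos hcyl.ne' (measure_ne_top μ _)
  have hfreq : ∀ᵐ γ ∂μ, ∀ k : ℕ, ∃ C : ℝ, ∀ n : ℕ,
      n * ((μ cyl8).toReal - 1 / ((k : ℝ) + 1)) ≤ visits n γ + C :=
    ae_all_iff.mpr fun k => herg.ae_mul_le_birkhoffSum_indicator_add measurableSet_cyl8
      (sub_lt_self _ Nat.one_div_pos_of_nat)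
  filter_upwards [hfreq] with γ hγ f hf hray
  refine ⟨?_, mul_neg_of_pos_of_neg (by positivity) hlog⟩
  have hf0 : f ≠ 0 := by
    rintro rfl
    simpa using hf.2
  have hcone : ∀ n, f ∈ cone (pprod (fun m => cMat (γ m)) n) :=
    Set.mem_iInter.mp (hray ▸ ⟨1, zero_le_one, (one_smul ℝ f).symm⟩)
  have hlim : Tendsto (fun k : ℕ => (1 / 8) * ((μ cyl8).toReal - 1 / ((k : ℝ) + 1)) *
      Real.log (4 / 5)) atTop (nhds ((1 / 8) * (μ cyl8).toReal * Real.log (4 / 5))) := by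
    simpa using ((tendsto_one_div_add_atTop_nhds_zero_nat.const_sub
      (μ cyl8).toReal).const_mul (1 / 8 : ℝ)).mul_const (Real.log (4 / 5))
  exact ge_of_tendsto' hlim fun k =>
    let ⟨_, hC⟩ := hγ k
    limsup_log_perpNormInf_le hf0 hcone hC
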